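/- For every real number x with 0 ≤ x ≤ 1, one has (1 + √x) · ∑_{m=0}^∞ (−1/(2m−1)) · (C(2m,m)/4^m)² · (2·x^{1/4}/(1+√x))^{2m} = (1+x)^{1/2} · ∑_{m=0}^∞ (−1/(4m−1)) · (C(4m,2m)/4^{2m}) · (C(2m,m)/4^m) · (2√x/(1+x))^{2m}. -/

import Mathlib

open Set MeasureTheory intervalIntegral

/-- The normalized central binomial coefficient `C(2n, n) / 4 ^ n`. -/
noncomputable def normCentralBinom (n : ℕ) : ℝ := (Nat.choose (2 * n) n : ℝ) / 4 ^ n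

/-- The coefficient of `u ^ n` in the power series of `√(1 - u)`. -/
noncomputable def sqrtOneSubCoeff (n : ℕ) : ℝ := -1 / (2 * (n : ℝ) - 1) * normCentralBinom n

lemma normCentralBinom_zero : normCentralBinom 0 = 1 := by simp [normCentralBinom]

lemma normCentralBinom_nonneg (n : ℕ) : 0 ≤ normCentralBinom n := by
  unfold normCentralBinom; positivity

lemma normCentralBinom_succ (n : ℕ) :
    normCentralBinom (n + 1) = (2 * n + 1) / (2 * n + 2) * normCentralBinom n := by
  have h : ((n : ℝ) + 1) * (Nat.choose (2 * (n + 1)) (n + 1) : ℝ)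
      = 2 * (2 * n + 1) * (Nat.choose (2 * n) n : ℝ) := by
    exact_mod_cast Nat.succ_mul_centralBinom_succ n
  unfold normCentralBinom
  rw [pow_succ]
  field_simp
  linear_combination 2 * h

lemma two_mul_natCast_sub_one_ne_zero (n : ℕ) : 2 * (n : ℝ) - 1 ≠ 0 := by
  intro h
  have h' : (2 * n : ℝ) = 1 := by linarith
  have : 2 * n = 1 := by exact_mod_cast h'
  omega

lemma sqrtOneSubCoeff_zero : sqrtOneSubCoeff 0 = 1 := by
  simp [sqrtOneSubCoeff, normCentralBinom_zero]

lemma sqrtOneSubCoeff_succ_eq_sub (n : ℕ) :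
    sqrtOneSubCoeff (n + 1) = normCentralBinom (n + 1) - normCentralBinom n := by
  have h : 2 * ((n : ℝ) + 1) - 1 = 2 * n + 1 := by ring
  rw [sqrtOneSubCoeff, normCentralBinom_succ]
  push_cast
  rw [h]
  field_simp
  ring

lemma sqrtOneSubCoeff_succ (n : ℕ) :
    sqrtOneSubCoeff (n + 1) = (2 * n - 1) / (2 * n + 2) * sqrtOneSubCoeff n := by
  have h := two_mul_natCast_sub_one_ne_zero n
  rw [sqrtOneSubCoeff_succ_eq_sub, normCentralBinom_succ, sqrtOneSubCoeff]
  field_simp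
  ring

lemma abs_sqrtOneSubCoeff_succ (n : ℕ) :
    |sqrtOneSubCoeff (n + 1)| = normCentralBinom n - normCentralBinom (n + 1) := by
  rw [sqrtOneSubCoeff_succ_eq_sub, abs_of_nonpos, neg_sub]
  rw [normCentralBinom_succ, sub_nonpos]
  refine mul_le_of_le_one_left (normCentralBinom_nonneg n) ?_
  rw [div_le_one (by positivity)]
  linarith

lemma summable_abs_sqrtOneSubCoeff : Summable fun n => |sqrtOneSubCoeff n| := by
  rw [← summable_nat_add_iff 1]
  refine summable_of_sum_range_le (c := 1) (fun n => abs_nonneg _) fun N => ?_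
  simp_rw [abs_sqrtOneSubCoeff_succ]
  rw [Finset.sum_range_sub', normCentralBinom_zero]
  linarith [normCentralBinom_nonneg N]

lemma ringChoose_half (n : ℕ) :
    Ring.choose (1 / 2 : ℝ) n = (-1) ^ n * sqrtOneSubCoeff n := by
  induction n with
  | zero => simp [sqrtOneSubCoeff_zero]
  | succ n ih =>
    have h : Ring.choose (1 / 2 : ℝ) (n + 1)
        = Ring.choose (1 / 2 : ℝ) n * (1 / 2 - n) / (n + 1) := by
      have hn : (n.factorial : ℝ) ≠ 0 := by positivity
      rw [Ring.choose_eq_smul, Ring.choose_eq_smul, descPochhammer_succ_right,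
        Polynomial.smeval_mul]
      simp only [Polynomial.smeval_sub, Polynomial.smeval_X, Polynomial.smeval_natCast,
        Nat.factorial_succ, smul_eq_mul]
      push_cast
      field_simp
      simp only [nsmul_eq_mul, mul_one]
      ring
    rw [h, ih, sqrtOneSubCoeff_succ, pow_succ]
    field_simp
    ring

lemma abs_sqrtOneSubCoeff_mul_pow_le {u : ℝ} (hu : |u| ≤ 1) (n : ℕ) :
    ‖sqrtOneSubCoeff n * u ^ n‖ ≤ |sqrtOneSubCoeff n| := by
  rw [Real.norm_eq_abs, abs_mul, abs_pow]
  exact mul_le_of_le_one_right (abs_nonneg _) (pow_le_one₀ (abs_nonneg _) hu)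

lemma tsum_sqrtOneSubCoeff_of_abs_lt_one {u : ℝ} (hu : |u| < 1) :
    ∑' n, sqrtOneSubCoeff n * u ^ n = √(1 - u) := by
  have h := (Real.one_add_rpow_hasFPowerSeriesOnBall_zero (a := 1 / 2)).hasSum
    (y := -u) (by simpa [← ENNReal.ofReal_one, Metric.eball_ofReal] using hu)
  rw [zero_add, ← sub_eq_add_neg, ← Real.sqrt_eq_rpow] at h
  rw [← h.tsum_eq]
  congr 1
  ext n
  rw [binomialSeries_apply, ringChoose_half, List.ofFn_const, List.prod_replicate, smul_eq_mul,
    neg_pow u n]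
  have : ((-1 : ℝ) ^ n) * (-1) ^ n = 1 := by rw [← mul_pow]; simp
  linear_combination (-(sqrtOneSubCoeff n * u ^ n)) * this

lemma hasSum_sqrtOneSubCoeff {u : ℝ} (hu : |u| ≤ 1) :
    HasSum (fun n => sqrtOneSubCoeff n * u ^ n) √(1 - u) := by
  have hs : Summable fun n => sqrtOneSubCoeff n * u ^ n :=
    summable_abs_sqrtOneSubCoeff.of_norm_bounded (abs_sqrtOneSubCoeff_mul_pow_le hu)
  have hc : ContinuousOn (fun v : ℝ => ∑' n, sqrtOneSubCoeff n * v ^ n) (Icc (-1) 1) :=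
    continuousOn_tsum (fun n => by fun_prop) summable_abs_sqrtOneSubCoeff
      fun n v hv => abs_sqrtOneSubCoeff_mul_pow_le (abs_le.2 hv) n
  have heq : EqOn (fun v : ℝ => ∑' n, sqrtOneSubCoeff n * v ^ n) (fun v => √(1 - v))
      (Icc (-1) 1) := by
    refine EqOn.of_subset_closure (s := Ioo (-1) 1)
      (fun v hv => tsum_sqrtOneSubCoeff_of_abs_lt_one (abs_lt.2 hv)) hc (by fun_prop)
      Ioo_subset_Icc_self ?_
    rw [closure_Ioo (by norm_num)]
  have h := heq (abs_le.1 hu)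
  dsimp only at h
  rw [← h]
  exact hs.hasSum

lemma hasSum_integral_sqrt_one_sub {g : ℝ → ℝ} (hg : Continuous g) (hb : ∀ θ, |g θ| ≤ 1)
    (a b : ℝ) :
    HasSum (fun n => sqrtOneSubCoeff n * ∫ θ in a..b, g θ ^ n) (∫ θ in a..b, √(1 - g θ)) := by
  simp_rw [← intervalIntegral.integral_const_mul]
  refine hasSum_integral_of_dominated_convergence (fun n _ => |sqrtOneSubCoeff n|)
    (fun n => (by fun_prop : Continuous fun θ => sqrtOneSubCoeff n * g θ ^ n).aestronglyMeasurable)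
    (fun n => .of_forall fun θ _ => abs_sqrtOneSubCoeff_mul_pow_le (hb θ) n)
    (.of_forall fun θ _ => summable_abs_sqrtOneSubCoeff) (by simp)
    (.of_forall fun θ _ => hasSum_sqrtOneSubCoeff (hb θ))

lemma integral_cos_pow_two_mul (n : ℕ) :
    ∫ θ in (0 : ℝ)..2 * Real.pi, Real.cos θ ^ (2 * n) = 2 * Real.pi * normCentralBinom n := by
  induction n with
  | zero => simp [normCentralBinom_zero]
  | succ n ih =>
    rw [mul_add, mul_one, integral_cos_pow, ih, normCentralBinom_succ]
    simp
    ring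

lemma integral_cos_pow_two_mul_add_one (n : ℕ) :
    ∫ θ in (0 : ℝ)..2 * Real.pi, Real.cos θ ^ (2 * n + 1) = 0 := by
  induction n with
  | zero => simp
  | succ n ih =>
    rw [mul_add, mul_one, add_right_comm, integral_cos_pow, ih]
    simp

lemma integral_comp_cos_two_mul {F : ℝ → ℝ} (hF : Continuous F) :
    ∫ θ in (0 : ℝ)..2 * Real.pi, F (Real.cos (2 * θ))
      = ∫ θ in (0 : ℝ)..2 * Real.pi, F (Real.cos θ) := by
  have hc : Continuous fun θ => F (Real.cos θ) := hF.comp Real.continuous_cos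
  have hp : Function.Periodic (fun θ => F (Real.cos θ)) (2 * Real.pi) :=
    fun θ => by simp
  have h2 := hp.intervalIntegral_add_eq (2 * Real.pi) 0
  rw [intervalIntegral.integral_comp_mul_left (fun θ => F (Real.cos θ)) two_ne_zero, mul_zero,
    ← integral_add_adjacent_intervals (hc.intervalIntegrable 0 (2 * Real.pi))
      (hc.intervalIntegrable _ _), two_mul (2 * Real.pi), h2, zero_add, smul_eq_mul]
  ring

lemma hasSum_integral_sqrt_one_sub_sq_mul_cos_sq {k : ℝ} (hk : |k| ≤ 1) :
    HasSum (fun n => sqrtOneSubCoeff n * normCentralBinom n * k ^ (2 * n))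
      ((2 * Real.pi)⁻¹ * ∫ θ in (0 : ℝ)..2 * Real.pi, √(1 - (k * Real.cos θ) ^ 2)) := by
  have hb (θ : ℝ) : |(k * Real.cos θ) ^ 2| ≤ 1 := by
    rw [abs_pow, abs_mul]
    exact pow_le_one₀ (by positivity)
      (mul_le_one₀ hk (abs_nonneg _) (Real.abs_cos_le_one θ))
  convert! (hasSum_integral_sqrt_one_sub (by fun_prop) hb 0 (2 * Real.pi)).mul_left
    (2 * Real.pi)⁻¹ using 2 with n
  simp_rw [← pow_mul, mul_pow]
  rw [intervalIntegral.integral_const_mul, integral_cos_pow_two_mul]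
  field_simp

lemma hasSum_integral_sqrt_one_sub_mul_cos {z : ℝ} (hz : |z| ≤ 1) :
    HasSum (fun n => sqrtOneSubCoeff (2 * n) * normCentralBinom n * z ^ (2 * n))
      ((2 * Real.pi)⁻¹ * ∫ θ in (0 : ℝ)..2 * Real.pi, √(1 - z * Real.cos θ)) := by
  have hb (θ : ℝ) : |z * Real.cos θ| ≤ 1 := by
    rw [abs_mul]
    exact mul_le_one₀ hz (abs_nonneg _) (Real.abs_cos_le_one θ)
  have h := (hasSum_integral_sqrt_one_sub (by fun_prop) hb 0 (2 * Real.pi)).mul_left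
    (2 * Real.pi)⁻¹
  rw [← (mul_right_injective₀ (two_ne_zero' ℕ)).hasSum_iff] at h
  · convert! h using 2 with n
    simp_rw [Function.comp_apply, mul_pow]
    rw [intervalIntegral.integral_const_mul, integral_cos_pow_two_mul]
    field_simp
  · intro n hn
    obtain ⟨m, rfl⟩ : Odd n := by
      rw [← Nat.not_even_iff_odd, even_iff_exists_two_mul]
      rintro ⟨m, rfl⟩
      exact hn ⟨m, rfl⟩
    simp_rw [mul_pow]
    rw [intervalIntegral.integral_const_mul, integral_cos_pow_two_mul_add_one]
    simp

lemma one_add_mul_integral_sqrt_landen {s k z : ℝ} (hs : 0 ≤ s)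
    (hk : k ^ 2 = 4 * s / (1 + s) ^ 2) (hz : z = 2 * s / (1 + s ^ 2)) :
    (1 + s) * ∫ θ in (0 : ℝ)..2 * Real.pi, √(1 - (k * Real.cos θ) ^ 2)
      = √(1 + s ^ 2) * ∫ θ in (0 : ℝ)..2 * Real.pi, √(1 - z * Real.cos θ) := by
  rw [← integral_comp_cos_two_mul (F := fun t => √(1 - z * t)) (by fun_prop),
    ← intervalIntegral.integral_const_mul, ← intervalIntegral.integral_const_mul]
  congr 1
  ext θ
  nth_rewrite 1 [← Real.sqrt_sq (by positivity : 0 ≤ 1 + s)]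
  rw [← Real.sqrt_mul (by positivity), ← Real.sqrt_mul (by positivity), mul_pow, hk, hz,
    Real.cos_two_mul]
  congr 1
  field_simp
  ring

/-- Theorem 3 of the paper (Step 1): for `0 ≤ x ≤ 1`,
`(1+√x) ∑_m (−1/(2m−1)) (C(2m,m)/4^m)² (2x^{1/4}/(1+√x))^{2m}
 = (1+x)^{1/2} ∑_m (−1/(4m−1)) (C(4m,2m)/4^{2m}) (C(2m,m)/4^m) (2√x/(1+x))^{2m}`. -/
theorem landen_step_one (x : ℝ) (hx0 : 0 ≤ x) (hx1 : x ≤ 1) :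
    (1 + Real.sqrt x) *
      ∑' m : ℕ, (-1 / (2 * (m : ℝ) - 1)) * ((Nat.choose (2 * m) m : ℝ) / 4 ^ m) ^ 2 *
        (2 * x ^ ((1 : ℝ) / 4) / (1 + Real.sqrt x)) ^ (2 * m)
    = (1 + x) ^ ((1 : ℝ) / 2) *
      ∑' m : ℕ, (-1 / (4 * (m : ℝ) - 1)) * ((Nat.choose (4 * m) (2 * m) : ℝ) / 4 ^ (2 * m)) *
        ((Nat.choose (2 * m) m : ℝ) / 4 ^ m) * (2 * Real.sqrt x / (1 + x)) ^ (2 * m) := by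
  set s := √x with hs
  have hs0 : 0 ≤ s := Real.sqrt_nonneg x
  have hsx : s ^ 2 = x := Real.sq_sqrt hx0
  have hq : (x ^ ((1 : ℝ) / 4)) ^ 2 = s := by
    rw [← Real.rpow_natCast, ← Real.rpow_mul hx0, hs, Real.sqrt_eq_rpow]
    norm_num
  have hk : (2 * x ^ ((1 : ℝ) / 4) / (1 + s)) ^ 2 = 4 * s / (1 + s) ^ 2 := by
    rw [div_pow, mul_pow, hq]
    norm_num
  have hk1 : |2 * x ^ ((1 : ℝ) / 4) / (1 + s)| ≤ 1 := by
    rw [← sq_le_one_iff_abs_le_one, hk, div_le_one (by positivity)]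
    nlinarith [sq_nonneg (1 - s)]
  have hz1 : |2 * s / (1 + x)| ≤ 1 := by
    rw [abs_of_nonneg (by positivity), div_le_one (by positivity), ← hsx]
    nlinarith [sq_nonneg (1 - s)]
  have h := one_add_mul_integral_sqrt_landen (z := 2 * s / (1 + x)) hs0 hk (by rw [hsx])
  have h₁ := (hasSum_integral_sqrt_one_sub_sq_mul_cos_sq hk1).tsum_eq
  have h₂ := (hasSum_integral_sqrt_one_sub_mul_cos hz1).tsum_eq
  rw [hsx] at h
  have e₁ (m : ℕ) : (-1 / (2 * (m : ℝ) - 1)) * ((Nat.choose (2 * m) m : ℝ) / 4 ^ m) ^ 2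
      = sqrtOneSubCoeff m * normCentralBinom m := by
    rw [sqrtOneSubCoeff, normCentralBinom]
    ring
  have e₂ (m : ℕ) : (-1 / (4 * (m : ℝ) - 1)) *
      ((Nat.choose (4 * m) (2 * m) : ℝ) / 4 ^ (2 * m)) * ((Nat.choose (2 * m) m : ℝ) / 4 ^ m)
      = sqrtOneSubCoeff (2 * m) * normCentralBinom m := by
    rw [sqrtOneSubCoeff, normCentralBinom, normCentralBinom, ← mul_assoc 2 2 m]
    push_cast
    rw [← mul_assoc (2 : ℝ) 2 m]
    norm_num
  simp_rw [e₁, e₂]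
  rw [h₁, h₂, ← Real.sqrt_eq_rpow]
  linear_combination (2 * Real.pi)⁻¹ * h
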